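/- arXiv:2108.08595 — 2 statements merged into one kernel-verified Lean document; each statement's English description precedes it below -/
import Mathlib

section
/- For every integer k, the complex cosine restricted to the open vertical strip {z ∈ ℂ : kπ < Re z < (k+1)π} is injective, and its image is exactly ℂ ∖ ((−∞,−1] ∪ [1,+∞)). -/
open Complex

lemma cos_re_im (z : ℂ) : (Complex.cos z).re = Real.cos z.re * Real.cosh z.im ∧
    (Complex.cos z).im = -(Real.sin z.re * Real.sinh z.im) := by
  rw [Complex.cos_eq, ← Complex.ofReal_cos, ← Complex.ofReal_cosh, ← Complex.ofReal_sin,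
    ← Complex.ofReal_sinh]
  constructor <;> simp [-Complex.ofReal_cos, -Complex.ofReal_cosh, -Complex.ofReal_sin,
    -Complex.ofReal_sinh]

lemma sin_ne_strip (k : ℤ) (x : ℝ) (h1 : (k : ℝ) * Real.pi < x)
    (h2 : x < (k + 1 : ℝ) * Real.pi) : Real.sin x ≠ 0 := by
  intro h
  obtain ⟨n, hn⟩ := Real.sin_eq_zero_iff.1 h
  rw [← hn] at h1 h2
  have a := lt_of_mul_lt_mul_right h1 Real.pi_pos.le
  have b := lt_of_mul_lt_mul_right h2 Real.pi_pos.le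
  have a' : k < n := by exact_mod_cast a
  have b' : n < k + 1 := by exact_mod_cast b
  omega

/-- For every integer `k`, the complex cosine restricted to the open vertical strip
`{z : kπ < Re z < (k+1)π}` is injective, with image exactly `ℂ ∖ ((−∞,−1] ∪ [1,+∞))`. -/
theorem stmt11 (k : ℤ) :
    Set.InjOn Complex.cos
      {z : ℂ | (k : ℝ) * Real.pi < z.re ∧ z.re < (k + 1 : ℝ) * Real.pi} ∧
    Complex.cos '' {z : ℂ | (k : ℝ) * Real.pi < z.re ∧ z.re < (k + 1 : ℝ) * Real.pi} =
      {w : ℂ | ¬(w.im = 0 ∧ (w.re ≤ -1 ∨ 1 ≤ w.re))} := by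
  have hpi := Real.pi_pos
  constructor
  · rintro x ⟨hx1, hx2⟩ y ⟨hy1, hy2⟩ h
    obtain ⟨m, hm | hm⟩ := Complex.cos_eq_cos_iff.1 h
    · have hre : y.re = 2 * m * Real.pi + x.re := by
        rw [hm]; simp
      have a : (2 * m : ℝ) < 1 := lt_of_mul_lt_mul_right (by linarith) hpi.le
      have b : (-1 : ℝ) < 2 * m := lt_of_mul_lt_mul_right (by linarith) hpi.le
      have a' : 2 * m < 1 := by exact_mod_cast a
      have b' : -1 < 2 * m := by exact_mod_cast b
      have : m = 0 := by omega
      subst this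
      simp [hm]
    · have hre : y.re = 2 * m * Real.pi - x.re := by
        rw [hm]; simp
      have a : (2 * m : ℝ) < 2 * k + 2 := lt_of_mul_lt_mul_right (by linarith) hpi.le
      have b : (2 * k : ℝ) < 2 * m := lt_of_mul_lt_mul_right (by linarith) hpi.le
      have a' : 2 * m < 2 * k + 2 := by exact_mod_cast a
      have b' : 2 * k < 2 * m := by exact_mod_cast b
      omega
  · ext w
    constructor
    · rintro ⟨z, ⟨h1, h2⟩, rfl⟩ ⟨him, hre⟩
      have hs := sin_ne_strip k _ h1 h2
      rw [(cos_re_im z).2, neg_eq_zero, mul_eq_zero, or_iff_right hs, Real.sinh_eq_zero] at him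
      rw [(cos_re_im z).1, him, Real.cosh_zero, mul_one] at hre
      have := Real.sin_sq_add_cos_sq z.re
      have := pow_pos (abs_pos.2 hs) 2
      rw [sq_abs] at this
      rcases hre with h | h <;> nlinarith
    · intro hw
      obtain ⟨z, rfl⟩ := Complex.cos_surjective w
      have hs : Real.sin z.re ≠ 0 := by
        intro hs
        apply hw
        rw [(cos_re_im z).1, (cos_re_im z).2, hs]
        refine ⟨by simp, ?_⟩
        have hc := Real.one_le_cosh z.im
        rcases Real.sin_eq_zero_iff_cos_eq.1 hs with h | h <;> rw [h]
        · right; linarith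
        · left; linarith
      set m := ⌊z.re / Real.pi⌋ with hm
      have h1 : (m : ℝ) * Real.pi ≤ z.re := (le_div_iff₀ hpi).1 (Int.floor_le _)
      have h2 : z.re < (m + 1 : ℝ) * Real.pi := (div_lt_iff₀ hpi).1 (Int.lt_floor_add_one _)
      have h1 : (m : ℝ) * Real.pi < z.re := lt_of_le_of_ne h1 fun h =>
        hs (Real.sin_eq_zero_iff.2 ⟨m, h⟩)
      rcases Int.even_or_odd' (k - m) with ⟨n, hn | hn⟩
      · have hk : (k : ℝ) = m + 2 * n := by
          have : k = m + 2 * n := by omega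
          exact_mod_cast this
        refine ⟨2 * n * Real.pi + z, ?_, (Complex.cos_eq_cos_iff.2 ⟨n, Or.inl rfl⟩).symm⟩
        have hre : (2 * n * Real.pi + z : ℂ).re = 2 * n * Real.pi + z.re := by simp
        rw [Set.mem_setOf_eq, hre, hk]
        constructor <;> linarith
      · have hk : (k : ℝ) = m + (2 * n + 1) := by
          have : k = m + (2 * n + 1) := by omega
          exact_mod_cast this
        refine ⟨2 * (m + n + 1 : ℤ) * Real.pi - z, ?_,
          (Complex.cos_eq_cos_iff.2 ⟨m + n + 1, Or.inr rfl⟩).symm⟩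
        have hre : (2 * (m + n + 1 : ℤ) * Real.pi - z : ℂ).re
            = 2 * (m + n + 1) * Real.pi - z.re := by simp
        rw [Set.mem_setOf_eq, hre, hk]
        constructor <;> linarith
end

section
/- The restriction of μ to ℂ ∖ {k²π² : k ∈ ℕ ∪ {0}}, viewed as a map onto ℂ ∖ {1, −1}, is a covering map. -/
open Complex

/-- `μ(z) = Σ_{m≥0} (−1)^m z^m/(2m)!`, so that `μ(z²) = cos z`. -/
noncomputable def μ (z : ℂ) : ℂ :=
  ∑' m : ℕ, (-1) ^ m * z ^ m / ((2 * m).factorial : ℂ)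

lemma mu_sq (z : ℂ) : μ (z ^ 2) = cos z := by
  rw [Complex.cos_eq_tsum, μ]
  simp only [pow_mul]

lemma sq_surj (z : ℂ) : ∃ t : ℂ, t ^ 2 = z :=
  (isOpenQuotientMap_pow 2).surjective z

lemma mu_cont : Continuous μ := by
  rw [(isOpenQuotientMap_pow 2).isQuotientMap.continuous_iff]
  have : μ ∘ (fun z : ℂ => z ^ 2) = cos := funext mu_sq
  rw [this]
  exact Complex.continuous_cos

lemma cos_open : IsOpenMap (cos : ℂ → ℂ) := by
  have hd : Differentiable ℂ (cos : ℂ → ℂ) := Complex.differentiable_cos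
  rcases AnalyticOnNhd.is_constant_or_isOpenMap
    (g := (cos : ℂ → ℂ)) (fun z _ => hd.analyticAt z) with ⟨w, hw⟩ | h
  · exfalso
    have h0 := hw 0
    have h1 := hw Real.pi
    rw [Complex.cos_zero] at h0
    rw [Complex.cos_pi] at h1
    rw [← h0] at h1
    norm_num at h1
  · exact h

lemma mu_open : IsOpenMap μ := by
  intro O hO
  have : μ '' O = cos '' ((fun z : ℂ => z ^ 2) ⁻¹' O) := by
    ext w
    constructor
    · rintro ⟨z, hz, rfl⟩
      obtain ⟨t, rfl⟩ := sq_surj z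
      exact ⟨t, hz, (mu_sq t).symm⟩
    · rintro ⟨t, ht, rfl⟩
      exact ⟨t ^ 2, ht, mu_sq t⟩
  rw [this]
  exact cos_open _ (hO.preimage (by fun_prop))

lemma mu_shift (x : ℂ) (k : ℤ) : μ ((x + k * (2 * Real.pi)) ^ 2) = cos x := by
  rw [mu_sq, Complex.cos_add_int_mul_two_pi]

lemma cos_locInj (z : ℂ) (hz : sin z ≠ 0) :
    ∃ A : Set ℂ, IsOpen A ∧ z ∈ A ∧ Set.InjOn cos A := by
  have hd := Complex.hasStrictDerivAt_cos z
  have hd' := hd.hasStrictFDerivAt_equiv (neg_ne_zero.mpr hz)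
  refine ⟨(hd'.toOpenPartialHomeomorph cos).source,
    (hd'.toOpenPartialHomeomorph cos).open_source,
    hd'.mem_toOpenPartialHomeomorph_source, ?_⟩
  have := (hd'.toOpenPartialHomeomorph cos).injOn
  simpa using this

lemma mu_evenly (w : ℂ) (hw : w ≠ 1 ∧ w ≠ -1) : IsEvenlyCovered μ w ℤ := by
  obtain ⟨z, rfl⟩ := Complex.cos_surjective w
  have hz : sin z ≠ 0 := by
    rw [Ne, Complex.sin_eq_zero_iff_cos_eq]
    tauto
  obtain ⟨A₀, hA₀, hzA₀, hinj₀⟩ := cos_locInj z hz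
  have hSo : IsOpen {x : ℂ | sin x ≠ 0} :=
    isOpen_ne_fun Complex.continuous_sin continuous_const
  set A : Set ℂ := A₀ ∩ {x : ℂ | sin x ≠ 0} with hA
  have hAo : IsOpen A := hA₀.inter hSo
  have hzA : z ∈ A := ⟨hzA₀, hz⟩
  have hinj : Set.InjOn cos A := hinj₀.mono Set.inter_subset_left
  have hVo : IsOpen (cos '' A) := cos_open _ hAo
  let U : ℤ → Set ℂ := fun k => (fun x : ℂ => (x + k * (2 * Real.pi)) ^ 2) '' A
  have hUo (k : ℤ) : IsOpen (U k) := by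
    have : U k = (fun x : ℂ => x ^ 2) '' ((fun x : ℂ => x + k * (2 * Real.pi)) '' A) := by
      rw [Set.image_image]
    rw [this]
    exact (isOpenQuotientMap_pow 2).isOpenMap _
      ((Homeomorph.addRight ((k : ℂ) * (2 * Real.pi))).isOpenMap _ hAo)
  have hsurj (k : ℤ) : (U k).SurjOn μ (cos '' A) := by
    rintro _ ⟨x, hx, rfl⟩
    exact ⟨_, ⟨x, hx, rfl⟩, mu_shift x k⟩
  have hpi : (Real.pi : ℂ) ≠ 0 := by exact_mod_cast Real.pi_ne_zero
  refine .of_trivialization (t := hVo.trivializationDiscrete U (cos '' A) ?_ ?_ hsurj ?_ ?_)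
    ⟨z, hzA, rfl⟩
  · intro k W hW
    refine ⟨fun h => (h.preimage mu_cont).inter (hUo k), fun h => ?_⟩
    have : W = μ '' (μ ⁻¹' W ∩ U k) := by
      ext w
      constructor
      · intro hw'
        obtain ⟨u, hu, rfl⟩ := hsurj k (hW hw')
        exact ⟨u, ⟨hw', hu⟩, rfl⟩
      · rintro ⟨u, ⟨hu, _⟩, rfl⟩
        exact hu
    rw [this]
    exact mu_open _ h
  · rintro k _ ⟨x, hx, rfl⟩ _ ⟨y, hy, rfl⟩ hxy
    simp only [mu_shift] at hxy
    rw [hinj hx hy hxy]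
  · intro k j hkj
    rw [Function.onFun, Set.disjoint_left]
    rintro u ⟨x, hx, hxu⟩ ⟨y, hy, hyu⟩
    simp only at hxu hyu
    have hc : cos x = cos y := by rw [← mu_shift x k, ← mu_shift y j, hxu, hyu]
    obtain rfl := hinj hx hy hc
    rw [← hyu] at hxu
    rcases sq_eq_sq_iff_eq_or_eq_neg.mp hxu with h | h
    · apply hkj
      have h2 : (k : ℂ) * (2 * Real.pi) = j * (2 * Real.pi) := add_left_cancel h
      have h3 := mul_right_cancel₀ (mul_ne_zero two_ne_zero hpi) h2
      exact_mod_cast h3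
    · apply hx.2
      rw [Complex.sin_eq_zero_iff]
      refine ⟨-(k + j), ?_⟩
      push_cast
      linear_combination h / 2
  · rintro u ⟨x, hx, hxu⟩
    obtain ⟨t, rfl⟩ := sq_surj u
    rw [mu_sq, Complex.cos_eq_cos_iff] at hxu
    obtain ⟨k, h | h⟩ := hxu
    · refine Set.mem_iUnion.mpr ⟨k, x, hx, ?_⟩
      simp only [h]; ring
    · refine Set.mem_iUnion.mpr ⟨-k, x, hx, ?_⟩
      simp only [h]; push_cast; ring

lemma dom_eq : {z : ℂ | ∀ k : ℕ, z ≠ (k : ℂ) ^ 2 * (Real.pi : ℂ) ^ 2} =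
    μ ⁻¹' {w : ℂ | w ≠ 1 ∧ w ≠ -1} := by
  ext z
  obtain ⟨t, rfl⟩ := sq_surj z
  have h1 : (t ^ 2 ∈ μ ⁻¹' {w : ℂ | w ≠ 1 ∧ w ≠ -1}) ↔ sin t ≠ 0 := by
    rw [Ne, Complex.sin_eq_zero_iff_cos_eq]
    simp [mu_sq]
  rw [h1, Set.mem_ofPred_eq, Ne, Complex.sin_eq_zero_iff, not_exists]
  constructor
  · rintro h k rfl
    apply h k.natAbs
    have : ((k.natAbs : ℂ)) ^ 2 = (k : ℂ) ^ 2 := by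
      have h2 := congrArg (Int.cast : ℤ → ℂ) (Int.natAbs_sq k)
      rw [Int.cast_pow, Int.cast_pow, Int.cast_natCast] at h2
      exact h2
    rw [this]; ring
  · intro h k hk
    rw [← mul_pow] at hk
    rcases sq_eq_sq_iff_eq_or_eq_neg.mp hk with h' | h'
    · exact h k (by simpa using h')
    · exact h (-k) (by simpa using h')

lemma restrict_cov {f : ℂ → ℂ} {D S : Set ℂ} (hD : D = f ⁻¹' S) (h : Set.MapsTo f D S)
    (hf : IsCoveringMapOn f S) : IsCoveringMap h.restrict := by
  subst hD
  exact hf.isCoveringMap_restrictPreimage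

/-- The restriction of `μ` to `ℂ ∖ {k²π² : k ∈ ℕ ∪ {0}}`, viewed as a map onto
`ℂ ∖ {1, −1}`, is a covering map (in particular a continuous surjection). -/
theorem stmt12
    (h : Set.MapsTo μ {z : ℂ | ∀ k : ℕ, z ≠ (k : ℂ) ^ 2 * (Real.pi : ℂ) ^ 2}
      {w : ℂ | w ≠ 1 ∧ w ≠ -1}) :
    Function.Surjective h.restrict ∧ IsCoveringMap h.restrict := by
  constructor
  · rintro ⟨w, hw⟩
    obtain ⟨t, rfl⟩ := Complex.cos_surjective w
    refine ⟨⟨t ^ 2, ?_⟩, Subtype.ext (mu_sq t)⟩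
    rw [dom_eq]
    simpa only [Set.mem_preimage, mu_sq] using hw
  · exact restrict_cov dom_eq h fun w hw => (mu_evenly w hw).to_isEvenlyCovered_preimage
end
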